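/- Lemma 5.6: Let n ≥ 2, let B_n = {x^n ≈ x^{n+1}, x^n y ≈ y x^n, x²y ≈ xyx} (an identity basis of the variety P_n), and let 1 ≤ k ≤ ℓ < n and 1 ≤ p ≤ q < n. Then θ(B_n ∪ {x^p y^q ≈ y^q x^p}) ⊆ θ(B_n ∪ {x^k y^ℓ ≈ y^ℓ x^k}) — equivalently, the subvariety P_n{x^k y^ℓ ≈ y^ℓ x^k} is contained in the subvariety P_n{x^p y^q ≈ y^q x^p} — if and only if k ≤ p and ℓ ≤ q. -/

import Mathlib

/-! Common definitions: words, fully invariant congruences, identities and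
named varieties from the paper. -/

/-- The free monoid over the countably infinite alphabet `ℕ`. -/
abbrev FM : Type := FreeMonoid ℕ

/-- The letters `x, y, z, s, t, h` (pairwise distinct elements of `ℕ`). -/
def xL : FM := FreeMonoid.of 0
def yL : FM := FreeMonoid.of 1
def zL : FM := FreeMonoid.of 2
def sL : FM := FreeMonoid.of 3
def tL : FM := FreeMonoid.of 4
def hL : FM := FreeMonoid.of 5
/-- The indexed letters `z_i` and `t_i` (0-based; pairwise distinct, and distinct
from the named letters above). -/
def zV (i : ℕ) : FM := FreeMonoid.of (10 + 2 * i)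
def tV (i : ℕ) : FM := FreeMonoid.of (11 + 2 * i)

/-- A congruence on the free monoid is fully invariant if it is stable under all
monoid endomorphisms. -/
def IsFullyInvariant (θ : Con FM) : Prop :=
  ∀ (σ : FM →* FM) (u v : FM), θ u v → θ (σ u) (σ v)

/-- The smallest fully invariant congruence on `FM` containing a set of identities. -/
def fiCon (E : Set (FM × FM)) : Con FM :=
  sInf {c : Con FM | IsFullyInvariant c ∧ ∀ p ∈ E, c p.1 p.2}

/-- Two congruences (relations) permute: `α ∘ β = β ∘ α`. -/
def Permute (α β : Con FM) : Prop :=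
  Relation.Comp (⇑α) (⇑β) = Relation.Comp (⇑β) (⇑α)

/-- A monoid `M` satisfies the identity `p.1 ≈ p.2`. -/
def MSatisfies (M : Type*) [Monoid M] (p : FM × FM) : Prop :=
  ∀ φ : FM →* M, φ p.1 = φ p.2

/-- A monoid `M` satisfies all identities of a congruence `θ`. -/
def SatisfiesAll (θ : Con FM) (M : Type*) [Monoid M] : Prop :=
  ∀ u v : FM, θ u v → MSatisfies M (u, v)

/-- Every element of the monoid `M` has a two-sided inverse, i.e. `M` is a group. -/
def IsGroupMonoid (M : Type*) [Monoid M] : Prop :=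
  ∀ m : M, ∃ m' : M, m * m' = 1 ∧ m' * m = 1

/-- The dual of a congruence: `θ^δ = {(rev u, rev v) : (u, v) ∈ θ}`. -/
def dualCon (θ : Con FM) : Con FM where
  r a b := θ a.reverse b.reverse
  iseqv := ⟨fun _ => θ.refl _, fun h => θ.symm h, fun h h' => θ.trans h h'⟩
  mul' := fun {a b c d} h₁ h₂ => by
    show θ (a * c).reverse (b * d).reverse
    rw [FreeMonoid.reverse_mul, FreeMonoid.reverse_mul]
    exact θ.mul h₂ h₁

/-- σ1 : `xysxty ≈ yxsxty`. -/
def idσ1 : FM × FM := (xL*yL*sL*xL*tL*yL, yL*xL*sL*xL*tL*yL)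
/-- σ2 : `xsytxy ≈ xsytyx`. -/
def idσ2 : FM × FM := (xL*sL*yL*tL*xL*yL, xL*sL*yL*tL*yL*xL)
/-- σ3 : `xsxyty ≈ xsyxty`. -/
def idσ3 : FM × FM := (xL*sL*xL*yL*tL*yL, xL*sL*yL*xL*tL*yL)
/-- α1 : `xysxtxhy ≈ yxsxtxhy`. -/
def idα1 : FM × FM := (xL*yL*sL*xL*tL*xL*hL*yL, yL*xL*sL*xL*tL*xL*hL*yL)
/-- α2 : `xysxtyhx ≈ yxsxtyhx`. -/
def idα2 : FM × FM := (xL*yL*sL*xL*tL*yL*hL*xL, yL*xL*sL*xL*tL*yL*hL*xL)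
/-- α3 : `xysytxhx ≈ yxsytxhx`. -/
def idα3 : FM × FM := (xL*yL*sL*yL*tL*xL*hL*xL, yL*xL*sL*yL*tL*xL*hL*xL)

/-- `aIdent i` is the identity `α_i` for `i ∈ {1, 2, 3}`. -/
def aIdent (i : ℕ) : FM × FM := if i = 1 then idα1 else if i = 2 then idα2 else idα3
/-- `bIdent i` is `β_i`, obtained from `α_i` by reversing both sides. -/
def bIdent (i : ℕ) : FM × FM := ((aIdent i).1.reverse, (aIdent i).2.reverse)

/-- The ordered product `f 0 * f 1 * ⋯ * f (n-1)`. -/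
def prodRange (n : ℕ) (f : ℕ → FM) : FM := ((List.range n).map f).prod
/-- The ordered product `f 0 * f 1 * ⋯ * f (n-1)` over `Fin n`. -/
def prodFin (n : ℕ) (f : Fin n → FM) : FM := ((List.finRange n).map f).prod

/-- The word `w_n[π,τ]` (0-based indices). -/
def wWord (n : ℕ) (π τ : Equiv.Perm (Fin n)) : FM :=
  prodRange n (fun i => zV i * tV i) * xL *
    prodFin n (fun i => zV (π i) * zV (n + τ i)) * xL *
    prodRange n (fun i => tV (n + i) * zV (n + i))

/-- The word `w_n'[π,τ]`. -/
def wWord' (n : ℕ) (π τ : Equiv.Perm (Fin n)) : FM :=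
  prodRange n (fun i => zV i * tV i) * (xL * xL) *
    prodFin n (fun i => zV (π i) * zV (n + τ i)) *
    prodRange n (fun i => tV (n + i) * zV (n + i))

/-- The word `c_{n,m}[ρ]`. -/
def cWord (n m : ℕ) (ρ : Equiv.Perm (Fin (n + m))) : FM :=
  prodRange n (fun i => zV i * tV i) * (xL * yL) * tL *
    prodRange m (fun i => zV (n + i) * tV (n + i)) * xL *
    prodFin (n + m) (fun i => zV (ρ i)) * yL

/-- The word `c'_{n,m}[ρ]`. -/
def cWord' (n m : ℕ) (ρ : Equiv.Perm (Fin (n + m))) : FM :=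
  prodRange n (fun i => zV i * tV i) * (yL * xL) * tL *
    prodRange m (fun i => zV (n + i) * tV (n + i)) * xL *
    prodFin (n + m) (fun i => zV (ρ i)) * yL

/-- The word `c_{n,m,k}[ρ]`. -/
def cWord3 (n m k : ℕ) (ρ : Equiv.Perm (Fin (n + m + k))) : FM :=
  prodRange n (fun i => zV i * tV i) * (xL * yL) * tL *
    prodRange m (fun i => zV (n + i) * tV (n + i)) * xL *
    prodFin (n + m + k) (fun i => zV (ρ i)) * yL *
    prodRange k (fun i => tV (n + m + i) * zV (n + m + i))

/-- The word `c'_{n,m,k}[ρ]`. -/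
def cWord3' (n m k : ℕ) (ρ : Equiv.Perm (Fin (n + m + k))) : FM :=
  prodRange n (fun i => zV i * tV i) * (yL * xL) * tL *
    prodRange m (fun i => zV (n + i) * tV (n + i)) * xL *
    prodFin (n + m + k) (fun i => zV (ρ i)) * yL *
    prodRange k (fun i => tV (n + m + i) * zV (n + m + i))

/-- The equational theory of `D_∞`. -/
def θDinf : Con FM :=
  fiCon {(xL^2, xL^3), (xL^2 * yL, yL * xL^2), idσ1, idσ2, idσ3}
/-- The equational theory of `N`. -/
def θN : Con FM :=
  fiCon {(xL^2, xL^3), (xL^2 * yL, yL * xL^2), (xL*yL*xL*zL*xL, xL^2*yL*zL), idσ2, idσ3}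
/-- The equational theory of `K`. -/
def θK : Con FM :=
  fiCon {(xL^2*yL, xL^2*yL*xL), (xL*yL*xL, xL*yL*xL^2), (xL^2*yL^2, yL^2*xL^2)}
/-- The identity basis of `P_n`. -/
def basisP (n : ℕ) : Set (FM × FM) :=
  {(xL^n, xL^(n+1)), (xL^n * yL, yL * xL^n), (xL^2*yL, xL*yL*xL)}
/-- The equational theory of `P_n`. -/
def θP (n : ℕ) : Con FM := fiCon (basisP n)
/-- The equational theory of `R`. -/
def θR : Con FM :=
  fiCon ({(xL^2, xL^3), (xL^2*yL, yL*xL^2), idσ1, idσ2} ∪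
    {p : FM × FM | ∃ (n : ℕ) (π τ : Equiv.Perm (Fin n)),
        1 ≤ n ∧ p = (wWord n π τ, wWord' n π τ)})
/-- The equational theory of `Q_{r,s}`. -/
def θQ (r s : ℕ) : Con FM :=
  fiCon ({(xL^2, xL^3), (xL^2*yL, yL*xL^2), idσ3} ∪
    {p : FM × FM | ∃ i : ℕ, (i = 1 ∨ i = 2 ∨ i = 3) ∧ i ≠ r ∧ p = aIdent i} ∪
    {p : FM × FM | ∃ j : ℕ, (j = 1 ∨ j = 2 ∨ j = 3) ∧ j ≠ s ∧ p = bIdent j} ∪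
    {p : FM × FM | ∃ (n m : ℕ) (ρ : Equiv.Perm (Fin (n + m))),
        p = (cWord n m ρ, cWord' n m ρ) ∨
        p = ((cWord n m ρ).reverse, (cWord' n m ρ).reverse)})
/-- The equational theory of the variety `SL` of semilattice monoids. -/
def θSL : Con FM := fiCon {(xL, xL^2), (xL*yL, yL*xL)}

/-- `u` is a factor (contiguous subword) of `w`. -/
def IsFactor (u w : FM) : Prop := ∃ p q : FM, p * u * q = w

lemma isFactor_left {a b w : FM} (h : IsFactor (a * b) w) : IsFactor a w := by
  obtain ⟨p, q, hpq⟩ := h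
  exact ⟨p, b * q, by rw [← hpq]; simp [mul_assoc]⟩

lemma isFactor_right {a b w : FM} (h : IsFactor (a * b) w) : IsFactor b w := by
  obtain ⟨p, q, hpq⟩ := h
  exact ⟨p * a, q, by rw [← hpq]; simp [mul_assoc]⟩

/-- The Rees congruence associated with the ideal of non-factors of `w`. -/
def reesCon (w : FM) : Con FM where
  r u v := u = v ∨ (¬ IsFactor u w ∧ ¬ IsFactor v w)
  iseqv := by
    refine ⟨fun _ => Or.inl rfl, ?_, ?_⟩
    · intro a b h
      rcases h with rfl | ⟨h1, h2⟩
      · exact Or.inl rfl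
      · exact Or.inr ⟨h2, h1⟩
    · intro a b c h h'
      rcases h with rfl | ⟨h1, h2⟩
      · exact h'
      · rcases h' with rfl | ⟨h3, h4⟩
        · exact Or.inr ⟨h1, h2⟩
        · exact Or.inr ⟨h1, h4⟩
  mul' := by
    rintro a b c d (rfl | ⟨h1, h2⟩) (rfl | ⟨h3, h4⟩)
    · exact Or.inl rfl
    · exact Or.inr ⟨fun h => h3 (isFactor_right h), fun h => h4 (isFactor_right h)⟩
    · exact Or.inr ⟨fun h => h1 (isFactor_left h), fun h => h2 (isFactor_left h)⟩
    · exact Or.inr ⟨fun h => h1 (isFactor_left h), fun h => h2 (isFactor_left h)⟩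

/-- The Rees quotient monoid `S(w)`. -/
abbrev SMon (w : FM) : Type := (reesCon w).Quotient

/-- The number of occurrences of the letter `a` in the word `w`. -/
def occ (w : FM) (a : ℕ) : ℕ := (FreeMonoid.toList w).count a

/-- A word in which every letter occurs at most once. -/
def LinearW (w : FM) : Prop := ∀ a : ℕ, occ w a ≤ 1

/-- Assemble the word `b0 * t_1 * b_1 * ⋯ * t_m * b_m` from a first block and a list
of (simple letter, block) pairs. -/
def assemble (b0 : FM) (rest : List (ℕ × FM)) : FM :=
  b0 * (rest.map (fun p => FreeMonoid.of p.1 * p.2)).prod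

/-- `(b0, rest)` is the decomposition of `w` into alternating simple letters and blocks
consisting of multiple letters. -/
def IsDecomposition (w : FM) (b0 : FM) (rest : List (ℕ × FM)) : Prop :=
  w = assemble b0 rest ∧
  (∀ p ∈ rest, occ w p.1 = 1) ∧
  (∀ a ∈ FreeMonoid.toList b0, 2 ≤ occ w a) ∧
  (∀ p ∈ rest, ∀ a ∈ FreeMonoid.toList p.2, 2 ≤ occ w a)

/-- The identity `u ≈ v` is linear-balanced. -/
def LinearBalanced (u v : FM) : Prop :=
  ∃ (b0 c0 : FM) (urest vrest : List (ℕ × FM)),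
    IsDecomposition u b0 urest ∧ IsDecomposition v c0 vrest ∧
    urest.map Prod.fst = vrest.map Prod.fst ∧
    ∀ a : ℕ, (2 ≤ occ u a ∨ 2 ≤ occ v a) →
      occ b0 a = occ c0 a ∧ occ b0 a ≤ 1 ∧
      ∀ q ∈ urest.zip vrest, occ q.1.2 a = occ q.2.2 a ∧ occ q.1.2 a ≤ 1

/-- `w` is an isoterm for `θ`. -/
def IsIsoterm (θ : Con FM) (w : FM) : Prop := ∀ w' : FM, θ w w' → w' = w

lemma fiCon_le {E : Set (FM × FM)} {c : Con FM} (hc : IsFullyInvariant c)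
    (h : ∀ p ∈ E, c p.1 p.2) : fiCon E ≤ c :=
  sInf_le ⟨hc, h⟩

lemma fiCon_of_mem {E : Set (FM × FM)} {p : FM × FM} (h : p ∈ E) : fiCon E p.1 p.2 := by
  rintro c ⟨-, hc⟩
  exact hc p h

lemma isFullyInvariant_fiCon (E : Set (FM × FM)) : IsFullyInvariant (fiCon E) := by
  rintro σ u v h c ⟨hc, hE⟩
  exact hc σ u v (h c ⟨hc, hE⟩)

/-- The word substitution sending `x` to `u` and every other letter to `v`. -/
def substXY (u v : FM) : FM →* FM := FreeMonoid.lift fun i => if i = 0 then u else v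

lemma substXY_xL (u v : FM) : substXY u v xL = u := by simp [substXY, xL]

lemma substXY_yL (u v : FM) : substXY u v yL = v := by simp [substXY, yL]

/-- In a monoid satisfying `x²y ≈ xyx`, powers of `a` to the right of an occurrence of `a`
can be collected at that occurrence. -/
lemma pow_mul_mul_pow {M : Type*} [Monoid M] (h : ∀ x y : M, x ^ 2 * y = x * y * x)
    (a y : M) {k : ℕ} (hk : 1 ≤ k) (r : ℕ) : a ^ k * y * a ^ r = a ^ (k + r) * y := by
  obtain ⟨k, rfl⟩ := Nat.exists_eq_add_of_le' hk
  have key : ∀ r, a * y * a ^ r = a ^ (r + 1) * y := by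
    intro r
    induction r with
    | zero => simp
    | succ r ih =>
      calc a * y * a ^ (r + 1) = a * (y * a ^ r) * a := by simp only [pow_succ, mul_assoc]
        _ = a * (a * y * a ^ r) := by rw [← h]; simp only [pow_two, mul_assoc]
        _ = a ^ (r + 1 + 1) * y := by rw [ih, pow_succ' a (r + 1), mul_assoc]
  calc a ^ (k + 1) * y * a ^ r = a ^ k * (a * y * a ^ r) := by simp only [pow_succ, mul_assoc]
    _ = a ^ (k + 1 + r) * y := by
      rw [key, ← mul_assoc, ← pow_add]; congr 2; omega

lemma pow_mul_pow_comm_of_le {M : Type*} [Monoid M] (h : ∀ x y : M, x ^ 2 * y = x * y * x)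
    {a b : M} {k l p q : ℕ} (hk : 1 ≤ k) (hl : 1 ≤ l) (hab : a ^ k * b ^ l = b ^ l * a ^ k)
    (hkp : k ≤ p) (hlq : l ≤ q) : a ^ p * b ^ q = b ^ q * a ^ p := by
  obtain ⟨r, rfl⟩ := Nat.exists_eq_add_of_le hkp
  obtain ⟨s, rfl⟩ := Nat.exists_eq_add_of_le hlq
  calc a ^ (k + r) * b ^ (l + s) = a ^ (k + r) * b ^ l * b ^ s := by rw [pow_add b, mul_assoc]
    _ = b ^ l * a ^ (k + r) * b ^ s := by
      rw [← pow_mul_mul_pow h a _ hk, hab, mul_assoc (b ^ l), ← pow_add]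
    _ = b ^ (l + s) * a ^ (k + r) := pow_mul_mul_pow h b _ hl s

lemma occ_mul (u v : FM) (a : ℕ) : occ (u * v) a = occ u a + occ v a := by
  simp [occ, FreeMonoid.toList_mul]

lemma occ_pow (u : FM) (m a : ℕ) : occ (u ^ m) a = m * occ u a := by
  induction m with
  | zero => simp [occ]
  | succ m ih => rw [pow_succ, occ_mul, ih]; ring

/-- The leftmost letter of `w` among `x` and `y`, if there is one. -/
def firstXY (w : FM) : Option ℕ := (FreeMonoid.toList w).find? fun i => i = 0 ∨ i = 1

lemma firstXY_mul (u v : FM) : firstXY (u * v) = (firstXY u).or (firstXY v) := by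
  simp [firstXY, FreeMonoid.toList_mul, List.find?_append]

lemma firstXY_pow (u : FM) {m : ℕ} (hm : 1 ≤ m) : firstXY (u ^ m) = firstXY u := by
  induction m, hm using Nat.le_induction with
  | base => simp
  | succ m _ ih => rw [pow_succ, firstXY_mul, ih, Option.or_self]

lemma firstXY_eq_none {w : FM} : firstXY w = none ↔ occ w 0 = 0 ∧ occ w 1 = 0 := by
  simp only [firstXY, List.find?_eq_none, occ, List.count_eq_zero]
  constructor
  · intro h
    exact ⟨fun h0 => by simpa using h 0 h0, fun h1 => by simpa using h 1 h1⟩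
  · rintro ⟨h0, h1⟩ i hi
    simp only [decide_eq_true_eq]
    rintro (rfl | rfl) <;> contradiction

lemma firstXY_eq_some {w : FM} {i : ℕ} (h : firstXY w = some i) :
    (i = 0 ∨ i = 1) ∧ 1 ≤ occ w i := by
  refine ⟨by simpa using List.find?_some h, ?_⟩
  exact List.count_pos_iff.2 (List.mem_of_find?_eq_some h)

lemma firstXY_of_occ_zero {w : FM} (h : occ w 0 = 0) :
    firstXY w = if occ w 1 = 0 then none else some 1 := by
  split_ifs with h1
  · exact firstXY_eq_none.2 ⟨h, h1⟩
  · cases hw : firstXY w with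
    | none => exact absurd (firstXY_eq_none.1 hw).2 h1
    | some i =>
      obtain ⟨rfl | rfl, hi⟩ := firstXY_eq_some hw
      · omega
      · rfl

/-- The Rees congruence on words over `x, y`, recording the exponents and the leftmost letter,
in which all words with more than `p` occurrences of `x` or more than `q` of `y` are zero. -/
def firstOccCon (p q : ℕ) : Con FM where
  r u v := ((p < occ u 0 ∨ q < occ u 1) ∧ (p < occ v 0 ∨ q < occ v 1)) ∨
    (occ u 0 = occ v 0 ∧ occ u 1 = occ v 1 ∧ firstXY u = firstXY v)
  iseqv := ⟨fun _ => Or.inr ⟨rfl, rfl, rfl⟩, by grind, by grind⟩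
  mul' := by
    intro a b c d h h'
    simp only [occ_mul, firstXY_mul]
    rcases h with h | ⟨h0, h1, h2⟩
    · left; omega
    · rcases h' with h' | ⟨h0', h1', h2'⟩
      · left; omega
      · right; exact ⟨by omega, by omega, by rw [h2, h2']⟩

lemma firstOccCon_iff {p q : ℕ} {u v : FM} : firstOccCon p q u v ↔
    ((p < occ u 0 ∨ q < occ u 1) ∧ (p < occ v 0 ∨ q < occ v 1)) ∨
    (occ u 0 = occ v 0 ∧ occ u 1 = occ v 1 ∧ firstXY u = firstXY v) := Iff.rfl

/-- The equational theory of the quotient of the free monoid by `c`. -/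
def conTheory (c : Con FM) : Con FM where
  r u v := ∀ φ : FM →* FM, c (φ u) (φ v)
  iseqv := ⟨fun _ _ => c.refl _, fun h φ => c.symm (h φ), fun h h' φ => c.trans (h φ) (h' φ)⟩
  mul' h h' φ := by
    rw [map_mul φ, map_mul φ]
    exact c.mul (h φ) (h' φ)

lemma isFullyInvariant_conTheory (c : Con FM) : IsFullyInvariant (conTheory c) :=
  fun σ _ _ h φ => h (φ.comp σ)

lemma firstOccCon_pow_mul_comm {n p q : ℕ} (hp : p < n) (hq : q < n) (u v : FM) :
    firstOccCon p q (u ^ n * v) (v * u ^ n) := by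
  rw [firstOccCon_iff]
  simp only [occ_mul, occ_pow, firstXY_mul, firstXY_pow u (show 1 ≤ n by omega)]
  by_cases h : occ u 0 = 0 ∧ occ u 1 = 0
  · right
    rw [firstXY_eq_none.2 h]
    simp [h]
  · left
    rcases not_and_or.1 h with h | h
    · have := Nat.le_mul_of_pos_right n (Nat.pos_of_ne_zero h)
      omega
    · have := Nat.le_mul_of_pos_right n (Nat.pos_of_ne_zero h)
      omega

lemma firstOccCon_pow_succ {n p q : ℕ} (hp : p < n) (hq : q < n) (u : FM) :
    firstOccCon p q (u ^ n) (u ^ (n + 1)) := by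
  rw [firstOccCon_iff]
  simp only [occ_pow, firstXY_pow u (show 1 ≤ n by omega), firstXY_pow u (show 1 ≤ n + 1 by omega)]
  by_cases h : occ u 0 = 0 ∧ occ u 1 = 0
  · right
    simp [h]
  · left
    simp only [add_mul, one_mul]
    rcases not_and_or.1 h with h | h
    · have := Nat.le_mul_of_pos_right n (Nat.pos_of_ne_zero h)
      omega
    · have := Nat.le_mul_of_pos_right n (Nat.pos_of_ne_zero h)
      omega

lemma firstOccCon_sq_mul (p q : ℕ) (u v : FM) :
    firstOccCon p q (u ^ 2 * v) (u * v * u) := by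
  rw [firstOccCon_iff]
  right
  simp only [occ_mul, occ_pow, firstXY_mul, firstXY_pow u (show 1 ≤ 2 by omega)]
  refine ⟨by ring, by ring, ?_⟩
  cases firstXY u <;> simp

lemma firstOccCon_pow_mul_pow_comm {k l p q : ℕ} (hk : 1 ≤ k) (hkl : k ≤ l) (hpq : p ≤ q)
    (h : ¬(k ≤ p ∧ l ≤ q)) (u v : FM) :
    firstOccCon p q (u ^ k * v ^ l) (v ^ l * u ^ k) := by
  rw [firstOccCon_iff]
  by_cases hz : p < occ (u ^ k * v ^ l) 0 ∨ q < occ (u ^ k * v ^ l) 1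
  · left
    refine ⟨hz, ?_⟩
    simpa only [occ_mul, add_comm] using hz
  · right
    refine ⟨by simp only [occ_mul, add_comm], by simp only [occ_mul, add_comm], ?_⟩
    simp only [occ_mul, occ_pow, not_or, not_lt] at hz
    have pos : ∀ m i, i ≠ 0 → m ≤ m * i := fun m i hi =>
      Nat.le_mul_of_pos_right m (Nat.pos_of_ne_zero hi)
    by_cases hkp : k ≤ p
    · have h0 : occ v 0 = 0 := by
        by_contra h0
        have := pos l _ h0
        omega
      have h1 : occ v 1 = 0 := by
        by_contra h1
        have := pos l _ h1
        omega
      have hv := firstXY_eq_none.2 ⟨h0, h1⟩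
      rw [firstXY_mul, firstXY_mul, firstXY_pow v (hk.trans hkl), hv]
      simp
    · have h0 : occ u 0 = 0 := by
        by_contra h0
        have := pos k _ h0
        omega
      have h0' : occ v 0 = 0 := by
        by_contra h0'
        have := pos l _ h0'
        omega
      rw [firstXY_of_occ_zero (by simp [occ_mul, occ_pow, h0, h0']),
        firstXY_of_occ_zero (by simp [occ_mul, occ_pow, h0, h0'])]
      simp only [occ_mul, add_comm]

lemma not_firstOccCon_xL_yL {p q : ℕ} (hp : 1 ≤ p) (hq : 1 ≤ q) :
    ¬ firstOccCon p q (xL ^ p * yL ^ q) (yL ^ q * xL ^ p) := by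
  have hx : firstXY xL = some 0 := rfl
  have hy : firstXY yL = some 1 := rfl
  have hx0 : occ xL 0 = 1 := rfl
  have hx1 : occ xL 1 = 0 := rfl
  have hy0 : occ yL 0 = 0 := rfl
  have hy1 : occ yL 1 = 1 := rfl
  rw [firstOccCon_iff]
  simp [occ_mul, occ_pow, firstXY_mul, firstXY_pow _ hp, firstXY_pow _ hq, hx, hy, hx0, hx1,
    hy0, hy1]

/-- **Lemma 5.6.** For `1 ≤ k ≤ ℓ < n` and `1 ≤ p ≤ q < n`, one has
`P_n{x^k y^ℓ ≈ y^ℓ x^k} ⊆ P_n{x^p y^q ≈ y^q x^p}` iff `k ≤ p` and `ℓ ≤ q`. -/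
theorem lemma_5_6 (n : ℕ) (hn : 2 ≤ n) (k l p q : ℕ)
    (hk : 1 ≤ k) (hkl : k ≤ l) (hln : l < n)
    (hp : 1 ≤ p) (hpq : p ≤ q) (hqn : q < n) :
    (fiCon (basisP n ∪ {(xL ^ p * yL ^ q, yL ^ q * xL ^ p)}) ≤
        fiCon (basisP n ∪ {(xL ^ k * yL ^ l, yL ^ l * xL ^ k)})) ↔
      (k ≤ p ∧ l ≤ q) := by
  constructor
  · intro hle
    by_contra hc
    refine not_firstOccCon_xL_yL hp (hp.trans hpq) ?_
    have hkl_le : fiCon (basisP n ∪ {(xL ^ k * yL ^ l, yL ^ l * xL ^ k)}) ≤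
        conTheory (firstOccCon p q) := by
      refine fiCon_le (isFullyInvariant_conTheory _) ?_
      rintro _ ((rfl | rfl | rfl) | rfl) φ <;> simp only [map_mul, map_pow]
      · exact firstOccCon_pow_succ (by omega) hqn _
      · exact firstOccCon_pow_mul_comm (by omega) hqn _ _
      · exact firstOccCon_sq_mul p q _ _
      · exact firstOccCon_pow_mul_pow_comm hk hkl hpq hc _ _
    exact hkl_le (hle (fiCon_of_mem (Or.inr rfl))) (MonoidHom.id FM)
  · rintro ⟨hkp, hlq⟩
    refine fiCon_le (isFullyInvariant_fiCon _) ?_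
    rintro w (hw | rfl)
    · exact fiCon_of_mem (Or.inl hw)
    set θ := fiCon (basisP n ∪ {(xL ^ k * yL ^ l, yL ^ l * xL ^ k)})
    have hsq : ∀ a b : θ.Quotient, a ^ 2 * b = a * b * a := by
      intro a b
      induction a using Con.induction_on with | H u => ?_
      induction b using Con.induction_on with | H v => ?_
      have huv := isFullyInvariant_fiCon _ (substXY u v) _ _
        (fiCon_of_mem (E := basisP n ∪ {(xL ^ k * yL ^ l, yL ^ l * xL ^ k)})
          (p := (xL ^ 2 * yL, xL * yL * xL)) (Or.inl (Or.inr (Or.inr rfl))))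
      simp only [map_mul, map_pow, substXY_xL, substXY_yL] at huv
      exact (Con.eq θ).2 huv
    have hcomm : (xL : θ.Quotient) ^ k * (yL : θ.Quotient) ^ l =
        (yL : θ.Quotient) ^ l * (xL : θ.Quotient) ^ k :=
      (Con.eq θ).2 (fiCon_of_mem (p := (xL ^ k * yL ^ l, yL ^ l * xL ^ k)) (Or.inr rfl))
    exact (Con.eq θ).1 (pow_mul_pow_comm_of_le hsq hk (hk.trans hkl) hcomm hkp hlq)
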